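/- Let U ⊆ ℝ^M be open and r : U → ℝ^N a C³ immersion (the vectors g_α(x) = ∂_{q^α} r(x), α = 1,…,M, are linearly independent at every x). Then for all x ∈ U and all indices ρ, α, δ, β ∈ {1,…,M}, the covariant curvature satisfies the Gauss equation R_{ραδβ}(x) = ⟨P_x(∂²_{q^β q^α} r), P_x(∂²_{q^δ q^ρ} r)⟩ − ⟨P_x(∂²_{q^δ q^α} r), P_x(∂²_{q^β q^ρ} r)⟩, i.e. the Riemann–Christoffel tensor equals the second-fundamental-form combination τ^Λ_{αβ} τ_{δρ,Λ} − τ^Λ_{αδ} τ_{βρ,Λ}. -/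

import Mathlib

open scoped RealInnerProductSpace

noncomputable section

/-- Partial derivative of a vector-valued map in the `α`-th coordinate direction. -/
def pdv {M N : ℕ} (f : EuclideanSpace ℝ (Fin M) → EuclideanSpace ℝ (Fin N)) (α : Fin M)
    (x : EuclideanSpace ℝ (Fin M)) : EuclideanSpace ℝ (Fin N) :=
  fderiv ℝ f x (EuclideanSpace.single α 1)

/-- Partial derivative of a scalar-valued map in the `α`-th coordinate direction. -/
def pds {M : ℕ} (f : EuclideanSpace ℝ (Fin M) → ℝ) (α : Fin M)
    (x : EuclideanSpace ℝ (Fin M)) : ℝ :=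
  fderiv ℝ f x (EuclideanSpace.single α 1)

/-- The tangent vectors `g_α = ∂_{q^α} r`. -/
def gvec {M N : ℕ} (r : EuclideanSpace ℝ (Fin M) → EuclideanSpace ℝ (Fin N)) (α : Fin M)
    (x : EuclideanSpace ℝ (Fin M)) : EuclideanSpace ℝ (Fin N) :=
  pdv r α x

/-- The induced metric `g_{αβ} = ⟨g_α, g_β⟩`. -/
def gmat {M N : ℕ} (r : EuclideanSpace ℝ (Fin M) → EuclideanSpace ℝ (Fin N))
    (x : EuclideanSpace ℝ (Fin M)) : Matrix (Fin M) (Fin M) ℝ :=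
  Matrix.of fun α β => ⟪gvec r α x, gvec r β x⟫

/-- The Christoffel symbols of the second kind,
`Γ^γ_{αβ} = Σ_λ g^{γλ} ⟨∂_{q^β} g_α, g_λ⟩`. -/
def Γ2 {M N : ℕ} (r : EuclideanSpace ℝ (Fin M) → EuclideanSpace ℝ (Fin N))
    (γ α β : Fin M) (x : EuclideanSpace ℝ (Fin M)) : ℝ :=
  ∑ lam, (gmat r x)⁻¹ γ lam * ⟪pdv (gvec r α) β x, gvec r lam x⟫

/-- The mixed Riemann–Christoffel curvature
`R^γ_{αδβ} = ∂_{q^δ} Γ^γ_{αβ} - ∂_{q^β} Γ^γ_{αδ} + Σ_λ (Γ^λ_{αβ} Γ^γ_{λδ} - Γ^λ_{αδ} Γ^γ_{λβ})`. -/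
def Rmix {M N : ℕ} (r : EuclideanSpace ℝ (Fin M) → EuclideanSpace ℝ (Fin N))
    (γ α δ β : Fin M) (x : EuclideanSpace ℝ (Fin M)) : ℝ :=
  pds (Γ2 r γ α β) δ x - pds (Γ2 r γ α δ) β x +
    ∑ lam, (Γ2 r lam α β x * Γ2 r γ lam δ x - Γ2 r lam α δ x * Γ2 r γ lam β x)

/-- The covariant curvature `R_{ραδβ} = Σ_γ g_{γρ} R^γ_{αδβ}`. -/
def Rcov {M N : ℕ} (r : EuclideanSpace ℝ (Fin M) → EuclideanSpace ℝ (Fin N))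
    (ρ α δ β : Fin M) (x : EuclideanSpace ℝ (Fin M)) : ℝ :=
  ∑ γ, gmat r x γ ρ * Rmix r γ α δ β x

/-- `P_x`: the orthogonal projection of `ℝ^N` onto the orthogonal complement of
`span {g_1 x, …, g_M x}` (the normal space at `x`). -/
def nproj {M N : ℕ} (r : EuclideanSpace ℝ (Fin M) → EuclideanSpace ℝ (Fin N))
    (x : EuclideanSpace ℝ (Fin M)) (v : EuclideanSpace ℝ (Fin N)) : EuclideanSpace ℝ (Fin N) :=
  (Submodule.orthogonalProjectionOnto (Submodule.span ℝ (Set.range fun α => gvec r α x))ᗮ v :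
    EuclideanSpace ℝ (Fin N))

section Calculus

variable {ι E : Type*} [Fintype ι] [DecidableEq ι] [NormedAddCommGroup E] [NormedSpace ℝ E]
  {A : E → Matrix ι ι ℝ} {x : E}

theorem differentiableAt_matrix_det (hA : ∀ i j, DifferentiableAt ℝ (fun y => A y i j) x) :
    DifferentiableAt ℝ (fun y => (A y).det) x := by
  simp only [Matrix.det_apply']
  exact DifferentiableAt.fun_sum fun σ _ =>
    (HasFDerivAt.finsetProd fun i _ => (hA (σ i) i).hasFDerivAt).differentiableAt.const_mul _

theorem differentiableAt_matrix_inv (hA : ∀ i j, DifferentiableAt ℝ (fun y => A y i j) x)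
    (hdet : (A x).det ≠ 0) (i j : ι) : DifferentiableAt ℝ (fun y => (A y)⁻¹ i j) x := by
  simp only [Matrix.inv_def, Matrix.smul_apply, Ring.inverse_eq_inv', Matrix.adjugate_apply,
    smul_eq_mul]
  refine ((differentiableAt_matrix_det hA).inv hdet).mul (differentiableAt_matrix_det fun k l => ?_)
  by_cases hk : k = j
  · subst hk
    simp
  · simpa [Matrix.updateRow_ne hk] using hA k l

end Calculus

section Immersion

variable {M N : ℕ} {r : EuclideanSpace ℝ (Fin M) → EuclideanSpace ℝ (Fin N)}
  {x : EuclideanSpace ℝ (Fin M)}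

theorem contDiffAt_pdv {f : EuclideanSpace ℝ (Fin M) → EuclideanSpace ℝ (Fin N)} {m n : WithTop ℕ∞}
    (hf : ContDiffAt ℝ n f x) (hmn : m + 1 ≤ n) (α : Fin M) : ContDiffAt ℝ m (pdv f α) x :=
  (hf.fderiv_right hmn).clm_apply contDiffAt_const

theorem pdv_comm {f : EuclideanSpace ℝ (Fin M) → EuclideanSpace ℝ (Fin N)}
    (hf : ContDiffAt ℝ 2 f x) (α β : Fin M) : pdv (pdv f α) β x = pdv (pdv f β) α x := by
  have hd : DifferentiableAt ℝ (fderiv ℝ f) x :=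
    (hf.fderiv_right (m := 1) (by norm_num)).differentiableAt (by norm_num)
  have key (γ δ : Fin M) : pdv (pdv f γ) δ x =
      fderiv ℝ (fderiv ℝ f) x (EuclideanSpace.single δ 1) (EuclideanSpace.single γ 1) := by
    change fderiv ℝ (fun y => fderiv ℝ f y (EuclideanSpace.single γ 1)) x _ = _
    rw [fderiv_clm_apply hd (differentiableAt_const _)]
    simp
  rw [key, key]
  exact hf.isSymmSndFDerivAt (by simp) _ _

theorem pds_inner {f g : EuclideanSpace ℝ (Fin M) → EuclideanSpace ℝ (Fin N)}
    (hf : DifferentiableAt ℝ f x) (hg : DifferentiableAt ℝ g x) (δ : Fin M) :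
    pds (fun y => ⟪f y, g y⟫) δ x = ⟪f x, pdv g δ x⟫ + ⟪pdv f δ x, g x⟫ :=
  fderiv_inner_apply ℝ hf hg _

theorem pds_sum_mul {ι : Type*} [Fintype ι] {f g : ι → EuclideanSpace ℝ (Fin M) → ℝ}
    (hf : ∀ i, DifferentiableAt ℝ (f i) x) (hg : ∀ i, DifferentiableAt ℝ (g i) x) (δ : Fin M) :
    pds (fun y => ∑ i, f i y * g i y) δ x =
      ∑ i, (f i x * pds (g i) δ x + g i x * pds (f i) δ x) := by
  unfold pds
  rw [fderiv_fun_sum fun i _ => (hf i).fun_mul (hg i)]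
  simp only [sum_apply]
  refine Finset.sum_congr rfl fun i _ => ?_
  rw [fderiv_fun_mul (hf i) (hg i)]
  simp

theorem gmat_det_ne_zero (himm : LinearIndependent ℝ fun α => gvec r α x) :
    (gmat r x).det ≠ 0 :=
  Matrix.det_gram_ne_zero_iff_linearIndependent.mpr himm

theorem gmat_symm (r : EuclideanSpace ℝ (Fin M) → EuclideanSpace ℝ (Fin N))
    (x : EuclideanSpace ℝ (Fin M)) (α β : Fin M) : gmat r x α β = gmat r x β α :=
  real_inner_comm (gvec r β x) (gvec r α x)

/-- The Christoffel symbols are the coefficients of the tangential part of `∂_{q^β} g_α`. -/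
theorem sum_Γ2_mul_gmat (himm : LinearIndependent ℝ fun α => gvec r α x) (α β ρ : Fin M) :
    ∑ γ, Γ2 r γ α β x * gmat r x γ ρ = ⟪pdv (gvec r α) β x, gvec r ρ x⟫ := by
  have hu : IsUnit (gmat r x).det := (gmat_det_ne_zero himm).isUnit
  have h := congrFun (congrArg (fun A : Matrix (Fin M) (Fin M) ℝ => A.mulVec
    fun lam => ⟪pdv (gvec r α) β x, gvec r lam x⟫) (Matrix.mul_nonsing_inv _ hu)) ρ
  simp only [← Matrix.mulVec_mulVec, Matrix.one_mulVec] at h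
  rw [← h]
  simp only [Matrix.mulVec, dotProduct, Γ2]
  exact Finset.sum_congr rfl fun γ _ => by rw [gmat_symm, mul_comm]

theorem nproj_pdv_gvec (himm : LinearIndependent ℝ fun α => gvec r α x) (α β : Fin M) :
    nproj r x (pdv (gvec r α) β x) =
      pdv (gvec r α) β x - ∑ γ, Γ2 r γ α β x • gvec r γ x := by
  set K := Submodule.span ℝ (Set.range fun α => gvec r α x) with hK
  refine Submodule.eq_starProjection_of_mem_orthogonal (K := Kᗮ) ?_ ?_
  · rw [hK, Submodule.mem_orthogonal']
    intro u hu
    induction hu using Submodule.span_induction with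
    | mem u hu =>
      obtain ⟨ρ, rfl⟩ := hu
      simp only [inner_sub_left, sum_inner, real_inner_smul_left]
      exact sub_eq_zero.mpr (sum_Γ2_mul_gmat himm α β ρ).symm
    | zero => simp
    | add u v _ _ hu hv => rw [inner_add_right, hu, hv, add_zero]
    | smul c u _ hu => rw [inner_smul_right, hu, mul_zero]
  · rw [sub_sub_cancel]
    exact K.le_orthogonal_orthogonal (Submodule.sum_mem _ fun γ _ =>
      Submodule.smul_mem _ _ (Submodule.subset_span ⟨γ, rfl⟩))

theorem inner_nproj_nproj (r : EuclideanSpace ℝ (Fin M) → EuclideanSpace ℝ (Fin N))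
    (x : EuclideanSpace ℝ (Fin M)) (v w : EuclideanSpace ℝ (Fin N)) :
    ⟪nproj r x v, nproj r x w⟫ = ⟪nproj r x v, w⟫ :=
  Submodule.inner_orthogonalProjectionOnto_eq_of_mem_left
    (K := (Submodule.span ℝ (Set.range fun α => gvec r α x))ᗮ) _ w

theorem differentiableAt_Γ2 (hr : ContDiffAt ℝ 3 r x)
    (himm : LinearIndependent ℝ fun α => gvec r α x) (γ α β : Fin M) :
    DifferentiableAt ℝ (Γ2 r γ α β) x := by
  have hg (α : Fin M) : ContDiffAt ℝ 2 (gvec r α) x := contDiffAt_pdv hr (by norm_num) α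
  have hg' (α : Fin M) : DifferentiableAt ℝ (gvec r α) x := (hg α).differentiableAt (by norm_num)
  have hgg : DifferentiableAt ℝ (pdv (gvec r α) β) x :=
    (contDiffAt_pdv (m := 1) (hg α) (by norm_num) β).differentiableAt (by norm_num)
  exact DifferentiableAt.fun_sum fun lam _ =>
    (differentiableAt_matrix_inv (fun i j => (hg' i).inner ℝ (hg' j))
      (gmat_det_ne_zero himm) γ lam).mul (hgg.inner ℝ (hg' lam))

theorem sum_gmat_mul_pds_Γ2_add (hr : ContDiffAt ℝ 3 r x)
    (himm : ∀ᶠ y in nhds x, LinearIndependent ℝ fun α => gvec r α y) (ρ α δ β : Fin M) :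
    ∑ γ, gmat r x γ ρ * (pds (Γ2 r γ α β) δ x + ∑ lam, Γ2 r lam α β x * Γ2 r γ lam δ x) =
      ⟪pdv (pdv (gvec r α) β) δ x, gvec r ρ x⟫ +
        ⟪nproj r x (pdv (gvec r α) β x), nproj r x (pdv (gvec r ρ) δ x)⟫ := by
  have hx := himm.self_of_nhds
  have hg (α : Fin M) : ContDiffAt ℝ 2 (gvec r α) x := contDiffAt_pdv hr (by norm_num) α
  have hg' (α : Fin M) : DifferentiableAt ℝ (gvec r α) x := (hg α).differentiableAt (by norm_num)
  have hgg : DifferentiableAt ℝ (pdv (gvec r α) β) x :=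
    (contDiffAt_pdv (m := 1) (hg α) (by norm_num) β).differentiableAt (by norm_num)
  have hderiv : pds (fun y => ∑ γ, Γ2 r γ α β y * ⟪gvec r γ y, gvec r ρ y⟫) δ x =
      pds (fun y => ⟪pdv (gvec r α) β y, gvec r ρ y⟫) δ x := by
    exact congrArg (fun L : EuclideanSpace ℝ (Fin M) →L[ℝ] ℝ => L (EuclideanSpace.single δ 1))
      (Filter.EventuallyEq.fderiv_eq (himm.mono fun y hy => sum_Γ2_mul_gmat hy α β ρ))
  rw [pds_sum_mul (fun γ => differentiableAt_Γ2 hr hx γ α β)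
    (fun γ => (hg' γ).inner ℝ (hg' ρ)), pds_inner hgg (hg' ρ)] at hderiv
  simp only [pds_inner (hg' _) (hg' ρ), ← sum_Γ2_mul_gmat hx _ δ ρ] at hderiv
  rw [inner_nproj_nproj, nproj_pdv_gvec hx, inner_sub_left, sum_inner]
  simp only [real_inner_smul_left]
  have hswap : ∑ γ, gmat r x γ ρ * ∑ lam, Γ2 r lam α β x * Γ2 r γ lam δ x =
      ∑ γ, Γ2 r γ α β x * ∑ lam, Γ2 r lam γ δ x * gmat r x lam ρ := by
    simp only [Finset.mul_sum]
    rw [Finset.sum_comm]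
    exact Finset.sum_congr rfl fun _ _ => Finset.sum_congr rfl fun _ _ => by ring
  simp only [mul_add, Finset.sum_add_distrib] at hderiv ⊢
  rw [hswap]
  change _ + ∑ γ, gmat r x γ ρ * pds (Γ2 r γ α β) δ x = _ at hderiv
  linarith

end Immersion

/-- Gauss equation: for a `C³` immersion `r : U → ℝ^N` on an open
`U ⊆ ℝ^M`, at every `x ∈ U` and all indices `ρ α δ β`,
`R_{ραδβ} = ⟨P_x(∂²_{q^β q^α} r), P_x(∂²_{q^δ q^ρ} r)⟩ - ⟨P_x(∂²_{q^δ q^α} r), P_x(∂²_{q^β q^ρ} r)⟩`,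
i.e. the Riemann–Christoffel tensor equals the second-fundamental-form combination
`τ^Λ_{αβ} τ_{δρ,Λ} - τ^Λ_{αδ} τ_{βρ,Λ}`. -/
theorem gauss_equation {M N : ℕ}
    (U : Set (EuclideanSpace ℝ (Fin M))) (hU : IsOpen U)
    (r : EuclideanSpace ℝ (Fin M) → EuclideanSpace ℝ (Fin N))
    (hr : ContDiffOn ℝ 3 r U)
    (himm : ∀ x ∈ U, LinearIndependent ℝ fun α => gvec r α x) :
    ∀ x ∈ U, ∀ ρ α δ β : Fin M,
      Rcov r ρ α δ β x =
        ⟪nproj r x (pdv (gvec r α) β x), nproj r x (pdv (gvec r ρ) δ x)⟫ -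
        ⟪nproj r x (pdv (gvec r α) δ x), nproj r x (pdv (gvec r ρ) β x)⟫ := by
  intro x hx ρ α δ β
  have hrx : ContDiffAt ℝ 3 r x := hr.contDiffAt (hU.mem_nhds hx)
  have himm' : ∀ᶠ y in nhds x, LinearIndependent ℝ fun α => gvec r α y :=
    Filter.mem_of_superset (hU.mem_nhds hx) himm
  have hcomm := pdv_comm (contDiffAt_pdv (m := 2) hrx (by norm_num) α) β δ
  change pdv (pdv (gvec r α) β) δ x = pdv (pdv (gvec r α) δ) β x at hcomm
  have h₁ := sum_gmat_mul_pds_Γ2_add hrx himm' ρ α δ β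
  have h₂ := sum_gmat_mul_pds_Γ2_add hrx himm' ρ α β δ
  rw [← add_sub_add_left_eq_sub _ _ ⟪pdv (pdv (gvec r α) β) δ x, gvec r ρ x⟫, ← h₁, hcomm, ← h₂,
    ← Finset.sum_sub_distrib]
  refine Finset.sum_congr rfl fun γ _ => ?_
  rw [Rmix, Finset.sum_sub_distrib]
  ring

end
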